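/- With the same setup, let G = Φ*Φ and suppose additionally that all entries of K are bounded in absolute value by ‖k‖_∞. Then ‖c‖₂ ≤ 2‖k‖_∞ ‖G^{-1}‖^{1/2} ϑ^{-1} N ‖y‖₂, where ‖G^{-1}‖ denotes the operator 2-norm. -/

import Mathlib

open Matrix

noncomputable def evNorm {N : ℕ} (v : Fin N → ℂ) : ℝ :=
  Real.sqrt (∑ i, ‖v i‖ ^ 2)

theorem evNorm_eq_norm_toLp {N : ℕ} (v : Fin N → ℂ) : evNorm v = ‖WithLp.toLp 2 v‖ := by
  rw [EuclideanSpace.norm_eq]; rfl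

theorem evNorm_nonneg {N : ℕ} (v : Fin N → ℂ) : 0 ≤ evNorm v := Real.sqrt_nonneg _

theorem evNorm_smul {N : ℕ} (t : ℂ) (v : Fin N → ℂ) : evNorm (t • v) = ‖t‖ * evNorm v := by
  simp only [evNorm_eq_norm_toLp, WithLp.toLp_smul, norm_smul]

theorem evNorm_sub_le {N : ℕ} (u v : Fin N → ℂ) : evNorm (u - v) ≤ evNorm u + evNorm v := by
  simp only [evNorm_eq_norm_toLp, WithLp.toLp_sub]
  exact norm_sub_le _ _

theorem norm_star_dotProduct_le {N : ℕ} (u v : Fin N → ℂ) :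
    ‖star u ⬝ᵥ v‖ ≤ evNorm u * evNorm v := by
  have h := norm_inner_le_norm (𝕜 := ℂ) (WithLp.toLp 2 u) (WithLp.toLp 2 v)
  rwa [EuclideanSpace.inner_toLp_toLp, dotProduct_comm, ← evNorm_eq_norm_toLp,
    ← evNorm_eq_norm_toLp] at h

theorem evNorm_sq_eq_re {N : ℕ} (u : Fin N → ℂ) : evNorm u ^ 2 = (star u ⬝ᵥ u).re := by
  have h := norm_sq_eq_re_inner (𝕜 := ℂ) (WithLp.toLp 2 u)
  rwa [EuclideanSpace.inner_toLp_toLp, dotProduct_comm, ← evNorm_eq_norm_toLp] at h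

theorem evNorm_mulVec_le_opNorm {N : ℕ} (A : Matrix (Fin N) (Fin N) ℂ) (v : Fin N → ℂ) :
    evNorm (A *ᵥ v) ≤ ‖Matrix.toEuclideanCLM (𝕜 := ℂ) A‖ * evNorm v := by
  have h := (Matrix.toEuclideanCLM (𝕜 := ℂ) A).le_opNorm (WithLp.toLp 2 v)
  rwa [Matrix.toEuclideanCLM_toLp, ← evNorm_eq_norm_toLp, ← evNorm_eq_norm_toLp] at h

theorem evNorm_mulVec_le_of_entry_le {N : ℕ} (A : Matrix (Fin N) (Fin N) ℂ) {b : ℝ}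
    (hb : 0 ≤ b) (hA : ∀ i j, ‖A i j‖ ≤ b) (v : Fin N → ℂ) :
    evNorm (A *ᵥ v) ≤ N * b * evNorm v := by
  have hv : evNorm v ^ 2 = ∑ j, ‖v j‖ ^ 2 := Real.sq_sqrt (by positivity)
  refine Real.sqrt_le_iff.mpr ⟨mul_nonneg (by positivity) (evNorm_nonneg v), ?_⟩
  have key : ∀ i, ‖(A *ᵥ v) i‖ ^ 2 ≤ N * b ^ 2 * evNorm v ^ 2 := by
    intro i
    have h1 : ‖(A *ᵥ v) i‖ ≤ b * ∑ j, ‖v j‖ := by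
      rw [Finset.mul_sum]
      change ‖∑ j, A i j * v j‖ ≤ _
      refine (norm_sum_le _ _).trans (Finset.sum_le_sum fun j _ => ?_)
      rw [norm_mul]
      exact mul_le_mul_of_nonneg_right (hA i j) (norm_nonneg _)
    have h2 : (∑ j, ‖v j‖) ^ 2 ≤ N * evNorm v ^ 2 := by
      rw [hv]
      simpa using sq_sum_le_card_mul_sum_sq (s := Finset.univ) (f := fun j => ‖v j‖)
    calc ‖(A *ᵥ v) i‖ ^ 2 ≤ (b * ∑ j, ‖v j‖) ^ 2 := by gcongr
      _ = b ^ 2 * (∑ j, ‖v j‖) ^ 2 := by ring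
      _ ≤ b ^ 2 * (N * evNorm v ^ 2) := by gcongr
      _ = N * b ^ 2 * evNorm v ^ 2 := by ring
  calc ∑ i, ‖(A *ᵥ v) i‖ ^ 2 ≤ ∑ _i : Fin N, N * b ^ 2 * evNorm v ^ 2 :=
        Finset.sum_le_sum fun i _ => key i
    _ = (N * b * evNorm v) ^ 2 := by simp; ring

theorem star_dotProduct_mulVec {N k : ℕ} (A : Matrix (Fin N) (Fin k) ℂ) (u : Fin N → ℂ)
    (v : Fin k → ℂ) : star u ⬝ᵥ (A *ᵥ v) = star (Aᴴ *ᵥ u) ⬝ᵥ v := by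
  rw [dotProduct_mulVec, star_mulVec, conjTranspose_conjTranspose]

open scoped ComplexOrder in
/-- Vectors of a coefficient space are controlled through the inverse Gram matrix. -/
theorem evNorm_le_sqrt_gram_inv_mul {N k : ℕ} (Φ : Matrix (Fin N) (Fin k) ℂ)
    (hΦ : LinearIndependent ℂ (fun j => fun i => Φ i j)) (c : Fin k → ℂ) :
    evNorm c ≤ Real.sqrt ‖Matrix.toEuclideanCLM (𝕜 := ℂ) (Φᴴ * Φ)⁻¹‖ * evNorm (Φ *ᵥ c) := by
  have hpd : (Φᴴ * Φ).PosDef :=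
    Matrix.PosDef.conjTranspose_mul_self Φ (Matrix.mulVec_injective_iff.mpr hΦ)
  have hdet : IsUnit (Φᴴ * Φ).det := (Matrix.isUnit_iff_isUnit_det _).mp hpd.isUnit
  set G := Φᴴ * Φ with hG
  set g := ‖Matrix.toEuclideanCLM (𝕜 := ℂ) G⁻¹‖ with hg
  have hg0 : 0 ≤ g := norm_nonneg _
  set u := Φ *ᵥ (G⁻¹ *ᵥ c) with hu
  have hΦu : Φᴴ *ᵥ u = c := by
    rw [hu, mulVec_mulVec, ← hG, mulVec_mulVec, Matrix.mul_nonsing_inv _ hdet, one_mulVec]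
  have h1 : evNorm c ^ 2 ≤ evNorm u * evNorm (Φ *ᵥ c) := by
    rw [evNorm_sq_eq_re]
    nth_rw 1 [← hΦu]
    rw [← star_dotProduct_mulVec]
    exact (Complex.re_le_norm _).trans (norm_star_dotProduct_le _ _)
  have h2 : evNorm u ^ 2 ≤ g * evNorm c ^ 2 := by
    rw [evNorm_sq_eq_re]
    nth_rw 2 [hu]
    rw [star_dotProduct_mulVec, hΦu]
    calc _ ≤ evNorm c * evNorm (G⁻¹ *ᵥ c) :=
          (Complex.re_le_norm _).trans (norm_star_dotProduct_le _ _)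
      _ ≤ evNorm c * (g * evNorm c) :=
          mul_le_mul_of_nonneg_left (evNorm_mulVec_le_opNorm _ _) (evNorm_nonneg _)
      _ = g * evNorm c ^ 2 := by ring
  have h3 : evNorm u ≤ Real.sqrt g * evNorm c := by
    refine (sq_le_sq₀ (evNorm_nonneg _)
      (mul_nonneg (Real.sqrt_nonneg _) (evNorm_nonneg _))).mp ?_
    rwa [mul_pow, Real.sq_sqrt hg0]
  rcases (evNorm_nonneg c).eq_or_lt with h0 | hpos
  · rw [← h0]
    exact mul_nonneg (Real.sqrt_nonneg _) (evNorm_nonneg _)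
  · refine le_of_mul_le_mul_left ?_ hpos
    nlinarith [mul_le_mul_of_nonneg_right h3 (evNorm_nonneg (Φ *ᵥ c))]

/-- bound on the polynomial part coefficients `c`. -/
theorem stmt1 {N k : ℕ} (K : Matrix (Fin N) (Fin N) ℂ) (hK : K.IsHermitian)
    (kInf : ℝ) (hkInf : ∀ i j, ‖K i j‖ ≤ kInf)
    (Φ : Matrix (Fin N) (Fin k) ℂ)
    (hΦ : LinearIndependent ℂ (fun j => fun i => Φ i j))
    (P : Matrix (Fin N) (Fin N) ℂ)
    (hP : P = Φ * (Φᴴ * Φ)⁻¹ * Φᴴ)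
    (Pperp : Matrix (Fin N) (Fin N) ℂ) (hPperp : Pperp = 1 - P)
    (G : Matrix (Fin k) (Fin k) ℂ) (hG : G = Φᴴ * Φ)
    (a y : Fin N → ℂ) (c : Fin k → ℂ)
    (ha : Pperp *ᵥ a = a)
    (hsys : K *ᵥ a + Φ *ᵥ c = y)
    (hconstr : Φᴴ *ᵥ a = 0)
    (ϑ : ℝ) (hϑpos : 0 < ϑ)
    (hϑ : ∀ x : Fin N → ℂ, evNorm (Pperp *ᵥ x) = 1 →
      ϑ ≤ (star x ⬝ᵥ (Pperp *ᵥ (K *ᵥ (Pperp *ᵥ x)))).re)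
    (hbig : 1 ≤ (N : ℝ) * kInf / ϑ) :
    evNorm c ≤ 2 * kInf * Real.sqrt ‖Matrix.toEuclideanCLM (𝕜 := ℂ) G⁻¹‖ *
      ϑ⁻¹ * (N : ℝ) * evNorm y := by
  subst hG
  have hN : (0 : ℝ) < N := by
    rcases Nat.eq_zero_or_pos N with h | h
    · subst h; norm_num at hbig
    · exact_mod_cast h
  have hkpos : 0 ≤ kInf := by
    have i : Fin N := ⟨0, by exact_mod_cast hN⟩
    exact (norm_nonneg _).trans (hkInf i i)
  have hperp : ∀ v, star a ⬝ᵥ (Pperp *ᵥ v) = star a ⬝ᵥ v := by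
    intro v
    rw [hPperp, hP, sub_mulVec, one_mulVec, dotProduct_sub, Matrix.mul_assoc, ← mulVec_mulVec,
      star_dotProduct_mulVec, hconstr]
    simp
  have hay : star a ⬝ᵥ (K *ᵥ a) = star a ⬝ᵥ y := by
    rw [← hsys, dotProduct_add, star_dotProduct_mulVec Φ, hconstr]
    simp
  have hya : ϑ * evNorm a ≤ evNorm y := by
    rcases (evNorm_nonneg a).eq_or_lt with h0 | hpos
    · rw [← h0, mul_zero]
      exact evNorm_nonneg y
    · set r := evNorm a with hr
      have h := hϑ (((r⁻¹ : ℝ) : ℂ) • a) (by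
        rw [mulVec_smul, ha, evNorm_smul, ← hr, Complex.norm_real, Real.norm_of_nonneg
          (inv_nonneg.mpr hpos.le), inv_mul_cancel₀ hpos.ne'])
      rw [mulVec_smul, ha, mulVec_smul, mulVec_smul, star_smul, smul_dotProduct,
        dotProduct_smul, hperp, hay, smul_eq_mul, smul_eq_mul, Complex.star_def,
        Complex.conj_ofReal, Complex.re_ofReal_mul, Complex.re_ofReal_mul] at h
      have h' : (star a ⬝ᵥ y).re ≤ r * evNorm y :=
        (Complex.re_le_norm _).trans (norm_star_dotProduct_le _ _)
      calc ϑ * r ≤ r⁻¹ * (r⁻¹ * (r * evNorm y)) * r := by gcongr; exact h.trans (by gcongr)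
        _ = evNorm y := by field_simp
  have hΦc : evNorm (Φ *ᵥ c) ≤ 2 * (N * kInf / ϑ) * evNorm y := by
    have hK' : evNorm (K *ᵥ a) ≤ N * kInf / ϑ * evNorm y :=
      calc evNorm (K *ᵥ a) ≤ N * kInf * evNorm a := evNorm_mulVec_le_of_entry_le K hkpos hkInf a
        _ = N * kInf / ϑ * (ϑ * evNorm a) := by field_simp
        _ ≤ _ := by gcongr
    have h1 := evNorm_sub_le y (K *ᵥ a)
    rw [← eq_sub_of_add_eq' hsys] at h1
    nlinarith [mul_le_mul_of_nonneg_right hbig (evNorm_nonneg y)]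
  calc evNorm c ≤ _ := evNorm_le_sqrt_gram_inv_mul Φ hΦ c
    _ ≤ Real.sqrt ‖Matrix.toEuclideanCLM (𝕜 := ℂ) (Φᴴ * Φ)⁻¹‖ *
        (2 * (N * kInf / ϑ) * evNorm y) := by gcongr
    _ = _ := by ring
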